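/- Let a > 0 and c > 0. Then for every real θ, ∫₀^∞ φ(θ; −av, cv) dv = (1/a)·exp(−(2/c)·max(aθ, 0)). Hence the support-vector-machine pseudo-likelihood exp(−2·max(θ, 0)·c^{-1}·a)/a, whose negative logarithm is (up to constants) the hinge loss max(aθ, 0), arises as a normal variance-mean mixture against the improper (Lebesgue) mixing measure on (0, ∞). -/

import Mathlib

open Real MeasureTheory Set

/-- The normal density with mean `m` and variance `v > 0`, evaluated at `x`. -/
noncomputable def normalPdf (x m v : ℝ) : ℝ :=
    (Real.sqrt (2 * Real.pi * v))⁻¹ * Real.exp (-(x - m) ^ 2 / (2 * v))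

open Filter Topology

/-- The integral over `(a, ∞)` of a nonnegative derivative is the difference of the limits of the
primitive at `∞` and at `a` from the right. -/
theorem integral_Ioi_of_hasDerivAt_of_nonneg_of_tendsto {g g' : ℝ → ℝ} {a l m : ℝ}
    (hderiv : ∀ x ∈ Ioi a, HasDerivAt g (g' x) x) (g'pos : ∀ x ∈ Ioi a, 0 ≤ g' x)
    (hl : Tendsto g (𝓝[>] a) (𝓝 l)) (hm : Tendsto g atTop (𝓝 m)) :
    ∫ x in Ioi a, g' x = m - l := by
  have hne : ∀ x ∈ Ioi a, Function.update g a l =ᶠ[𝓝 x] g := fun x hx => by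
    filter_upwards [Ioi_mem_nhds hx] with y hy
    exact Function.update_of_ne (ne_of_gt hy) _ _
  rw [integral_Ioi_of_hasDerivAt_of_nonneg (g := Function.update g a l) (l := m) _
    (fun x hx => (hderiv x hx).congr_of_eventuallyEq (hne x hx)) g'pos, Function.update_self]
  · refine hm.congr' ?_
    filter_upwards [Ioi_mem_atTop a] with y hy
    exact (Function.update_of_ne (ne_of_gt hy) _ _).symm
  · rw [continuousWithinAt_update_same, Ici_sdiff_left]
    exact hl

/-- The primitive of `exp (-t ^ 2)` vanishing at `0`. -/
noncomputable def gaussianPrimitive (x : ℝ) : ℝ := ∫ t in (0 : ℝ)..x, exp (-t ^ 2)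

theorem hasDerivAt_gaussianPrimitive (x : ℝ) :
    HasDerivAt gaussianPrimitive (exp (-x ^ 2)) x := by
  have h : Continuous fun t : ℝ => exp (-t ^ 2) := by fun_prop
  exact h.integral_hasStrictDerivAt 0 x |>.hasDerivAt

theorem gaussianPrimitive_zero : gaussianPrimitive 0 = 0 :=
  intervalIntegral.integral_same

theorem gaussianPrimitive_neg (x : ℝ) : gaussianPrimitive (-x) = -gaussianPrimitive x := by
  have h := intervalIntegral.integral_comp_neg (a := 0) (b := x) fun t : ℝ => exp (-t ^ 2)
  simp only [neg_sq, neg_zero] at h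
  rw [gaussianPrimitive, gaussianPrimitive, h, intervalIntegral.integral_symm]

theorem tendsto_gaussianPrimitive_atTop :
    Tendsto gaussianPrimitive atTop (𝓝 (√π / 2)) := by
  have hint : Integrable fun t : ℝ => exp (-t ^ 2) := by
    simpa using integrable_exp_neg_mul_sq one_pos
  have hval : ∫ t in Ioi (0 : ℝ), exp (-t ^ 2) = √π / 2 := by
    simpa using integral_gaussian_Ioi 1
  rw [← hval]
  exact intervalIntegral_tendsto_integral_Ioi 0 hint.integrableOn tendsto_id

theorem tendsto_gaussianPrimitive_atBot :
    Tendsto gaussianPrimitive atBot (𝓝 (-(√π / 2))) := by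
  refine (tendsto_gaussianPrimitive_atTop.comp tendsto_neg_atBot_atTop).neg.congr fun x => ?_
  simp [gaussianPrimitive_neg]

theorem tendsto_sqrt_nhdsGT_zero : Tendsto sqrt (𝓝[>] 0) (𝓝[>] 0) := by
  refine tendsto_nhdsWithin_iff.2 ⟨?_, ?_⟩
  · simpa using (continuous_sqrt.tendsto 0).mono_left nhdsWithin_le_nhds
  · filter_upwards [self_mem_nhdsWithin] with v hv using sqrt_pos.2 hv

theorem tendsto_mul_sqrt_add_div_sqrt_atTop {α : ℝ} (hα : 0 < α) (β : ℝ) :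
    Tendsto (fun v => α * √v + β / √v) atTop atTop :=
  (tendsto_sqrt_atTop.const_mul_atTop hα).atTop_add (tendsto_sqrt_atTop.const_div_atTop β)

theorem tendsto_mul_sqrt_add_div_sqrt_nhdsGT_zero (α : ℝ) {β : ℝ} (hβ : 0 < β) :
    Tendsto (fun v => α * √v + β / √v) (𝓝[>] 0) atTop := by
  have h₁ : Tendsto (fun v => α * √v) (𝓝[>] 0) (𝓝 (α * 0)) :=
    (tendsto_sqrt_nhdsGT_zero.mono_right nhdsWithin_le_nhds).const_mul α
  exact h₁.add_atTop
    ((tendsto_inv_nhdsGT_zero.comp tendsto_sqrt_nhdsGT_zero).const_mul_atTop hβ)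

theorem hasDerivAt_mul_sqrt_add_div_sqrt (α β : ℝ) {v : ℝ} (hv : 0 < v) :
    HasDerivAt (fun v => α * √v + β / √v) ((α - β / v) / (2 * √v)) v := by
  have hs : HasDerivAt sqrt (1 / (2 * √v)) v := hasDerivAt_sqrt hv.ne'
  have hw : 0 < √v := sqrt_pos.2 hv
  refine ((hs.const_mul α).add ((hs.inv hw.ne').const_mul β)).congr_deriv ?_
  rw [sq_sqrt hv.le]
  field_simp
  ring

/-- A primitive, on `(0, ∞)`, of a multiple of an inverse Gaussian type density. -/
noncomputable def cauchySchlomilchPrimitive (α β v : ℝ) : ℝ :=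
  gaussianPrimitive (α * √v + -β / √v) + exp (4 * (α * β)) * gaussianPrimitive (α * √v + β / √v)

theorem hasDerivAt_cauchySchlomilchPrimitive (α β : ℝ) {v : ℝ} (hv : 0 < v) :
    HasDerivAt (cauchySchlomilchPrimitive α β)
      (α * ((√v)⁻¹ * exp (-(α * √v - β / √v) ^ 2))) v := by
  have hw : 0 < √v := sqrt_pos.2 hv
  have h₁ := (hasDerivAt_gaussianPrimitive _).comp v (hasDerivAt_mul_sqrt_add_div_sqrt α (-β) hv)
  have h₂ := (hasDerivAt_gaussianPrimitive _).comp v (hasDerivAt_mul_sqrt_add_div_sqrt α β hv)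
  have he : exp (4 * (α * β)) * exp (-(α * √v + β / √v) ^ 2) =
      exp (-(α * √v - β / √v) ^ 2) := by
    rw [← exp_add]
    congr 1
    field_simp
    ring
  have hsub : α * √v + -β / √v = α * √v - β / √v := by ring
  refine (h₁.add (h₂.const_mul (exp (4 * (α * β))))).congr_deriv ?_
  rw [← mul_assoc, he, hsub]
  field_simp
  ring

theorem tendsto_cauchySchlomilchPrimitive_atTop {α : ℝ} (hα : 0 < α) (β : ℝ) :
    Tendsto (cauchySchlomilchPrimitive α β) atTop
      (𝓝 (√π / 2 + exp (4 * (α * β)) * (√π / 2))) :=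
  (tendsto_gaussianPrimitive_atTop.comp (tendsto_mul_sqrt_add_div_sqrt_atTop hα _)).add
    ((tendsto_gaussianPrimitive_atTop.comp
      (tendsto_mul_sqrt_add_div_sqrt_atTop hα _)).const_mul _)

theorem tendsto_cauchySchlomilchPrimitive_nhdsGT_zero (α : ℝ) {β : ℝ} (hβ : 0 ≤ β) :
    Tendsto (cauchySchlomilchPrimitive α β) (𝓝[>] 0)
      (𝓝 (-(√π / 2) + exp (4 * (α * β)) * (√π / 2))) := by
  rcases hβ.eq_or_lt with rfl | hβ
  · have hc : Continuous gaussianPrimitive :=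
      continuous_iff_continuousAt.2 fun x => (hasDerivAt_gaussianPrimitive x).continuousAt
    have h : Continuous (cauchySchlomilchPrimitive α 0) := by
      unfold cauchySchlomilchPrimitive
      simp only [neg_zero, zero_div, add_zero]
      fun_prop
    convert (h.tendsto 0).mono_left nhdsWithin_le_nhds using 2
    simp [cauchySchlomilchPrimitive, gaussianPrimitive_zero]
  · have h₁ : Tendsto (fun v => α * √v + -β / √v) (𝓝[>] 0) atBot := by
      refine (tendsto_neg_atTop_atBot.comp
        (tendsto_mul_sqrt_add_div_sqrt_nhdsGT_zero (-α) hβ)).congr fun v => ?_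
      simp only [Function.comp_apply]
      ring
    exact (tendsto_gaussianPrimitive_atBot.comp h₁).add
      ((tendsto_gaussianPrimitive_atTop.comp
        (tendsto_mul_sqrt_add_div_sqrt_nhdsGT_zero α hβ)).const_mul _)

theorem integral_inv_sqrt_mul_exp_neg_sq {α β : ℝ} (hα : 0 < α) (hβ : 0 ≤ β) :
    ∫ v in Ioi (0 : ℝ), (√v)⁻¹ * exp (-(α * √v - β / √v) ^ 2) = √π / α := by
  have h := integral_Ioi_of_hasDerivAt_of_nonneg_of_tendsto
    (fun v hv => hasDerivAt_cauchySchlomilchPrimitive α β hv) (fun v _ => by positivity)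
    (tendsto_cauchySchlomilchPrimitive_nhdsGT_zero α hβ)
    (tendsto_cauchySchlomilchPrimitive_atTop hα β)
  rw [integral_const_mul] at h
  rw [eq_div_iff hα.ne']
  linarith

theorem normalPdf_neg_mul_eq (a : ℝ) {c v : ℝ} (hc : 0 < c) (hv : 0 < v) (θ : ℝ) :
    normalPdf θ (-(a * v)) (c * v) =
      (√(2 * c) * √π)⁻¹ * exp (-(a * (θ + |θ|) / c)) *
        ((√v)⁻¹ * exp (-(a / √(2 * c) * √v - |θ| / √(2 * c) / √v) ^ 2)) := by
  have hs : 0 < √(2 * c) := sqrt_pos.2 (by positivity)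
  have hw : 0 < √v := sqrt_pos.2 hv
  have hs2 : √(2 * c) ^ 2 = 2 * c := sq_sqrt (by positivity)
  have hw2 : √v ^ 2 = v := sq_sqrt hv.le
  have hsqrt : √(2 * π * (c * v)) = √(2 * c) * √π * √v := by
    rw [← sqrt_mul (by positivity), ← sqrt_mul (by positivity)]
    ring_nf
  have hsq : (a / √(2 * c) * √v - |θ| / √(2 * c) / √v) ^ 2 =
      (a * v - |θ|) ^ 2 / (2 * (c * v)) := by
    have h : a / √(2 * c) * √v - |θ| / √(2 * c) / √v = (a * √v ^ 2 - |θ|) / (√(2 * c) * √v) := by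
      field_simp
    rw [h, hw2, div_pow, mul_pow, hs2, hw2, mul_assoc]
  have hexp : -(θ - -(a * v)) ^ 2 / (2 * (c * v)) =
      -(a * (θ + |θ|) / c) + -((a * v - |θ|) ^ 2 / (2 * (c * v))) := by
    field_simp
    linear_combination sq_abs θ
  rw [normalPdf, hsqrt, hsq, hexp, exp_add, mul_inv (_ * _)]
  ring

/-- The support-vector-machine pseudo-likelihood, whose negative logarithm is (up to
constants) the hinge loss `max(aθ, 0)`, arises as a normal variance-mean mixture against
the improper (Lebesgue) mixing measure on `(0, ∞)`. -/
theorem hinge_loss_is_variance_mean_mixture (a c : ℝ) (ha : 0 < a) (hc : 0 < c) (θ : ℝ) :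
    (∫ v in Ioi (0 : ℝ), normalPdf θ (-(a * v)) (c * v)) =
      (1 / a) * Real.exp (-(2 / c) * max (a * θ) 0) := by
  have hs : 0 < √(2 * c) := sqrt_pos.2 (by positivity)
  have hmax : a * (θ + |θ|) / c = 2 / c * max (a * θ) 0 := by
    rcases le_total 0 θ with h | h
    · rw [abs_of_nonneg h, max_eq_left (by positivity)]
      ring
    · rw [abs_of_nonpos h, max_eq_right (mul_nonpos_of_nonneg_of_nonpos ha.le h)]
      ring
  rw [setIntegral_congr_fun measurableSet_Ioi fun v hv => normalPdf_neg_mul_eq a hc hv θ,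
    integral_const_mul, integral_inv_sqrt_mul_exp_neg_sq (by positivity) (by positivity), hmax,
    neg_mul]
  have hπ : 0 < √π := sqrt_pos.2 pi_pos
  field_simp
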